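/- (Self-adjointness of the resolvent.) Let μ be a Lévy measure on ℝ^N \ {0}, ε > 0, g ∈ L^∞(ℝ^N) and f ∈ L¹(ℝ^N). Let v_g ∈ L^∞(ℝ^N) and v_f ∈ L¹(ℝ^N) be the unique distributional solutions of ε v_g − L^μ[v_g] = g and ε v_f − L^μ[v_f] = f respectively (i.e. ∫ ( ε v ψ − v L^μ[ψ] ) dx = ∫ (datum) ψ dx for all ψ ∈ C_c^∞(ℝ^N)). Then ∫_{ℝ^N} v_g(x) f(x) dx = ∫_{ℝ^N} g(x) v_f(x) dx. -/

import Mathlib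

open MeasureTheory Set Filter

noncomputable section

/-- Euclidean space `ℝ^N`. -/
abbrev Euc (N : ℕ) := EuclideanSpace ℝ (Fin N)

variable {N : ℕ}

/-- `μ` is a (symmetric) Lévy measure on `ℝ^N ∖ {0}` : it is a nonnegative measure giving no
mass to `{0}`, symmetric (`μ(−B) = μ(B)`), and `∫ min(|z|²,1) dμ(z) < ∞`. -/
def IsLevyMeasure (μ : Measure (Euc N)) : Prop :=
  μ {0} = 0 ∧ μ.map (fun z => -z) = μ ∧
    ∫⁻ z, ENNReal.ofReal (min (‖z‖ ^ 2) 1) ∂μ ≠ ⊤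

/-- The nonlocal operator
`L^μ[ψ](x) = ∫ (ψ(x+z) − ψ(x) − z·Dψ(x) 1_{|z|≤1}) dμ(z)`. -/
def Lop (μ : Measure (Euc N)) (ψ : Euc N → ℝ) (x : Euc N) : ℝ :=
  ∫ z, (ψ (x + z) - ψ x - (if ‖z‖ ≤ 1 then fderiv ℝ ψ x z else 0)) ∂μ

/-- `ψ ∈ C_c^∞(ℝ^N)`. -/
def IsTestFn (ψ : Euc N → ℝ) : Prop :=
  ContDiff ℝ (⊤ : ℕ∞) ψ ∧ HasCompactSupport ψ

/-- `ψ ∈ C_c^∞(ℝ^N × [0,T))` : smooth, compactly supported, and the support stays away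
from `t = T` (but may touch `t = 0`). -/
def IsSTTestFn (T : ℝ) (ψ : Euc N → ℝ → ℝ) : Prop :=
  ContDiff ℝ (⊤ : ℕ∞) (Function.uncurry ψ) ∧ HasCompactSupport (Function.uncurry ψ) ∧
    tsupport (Function.uncurry ψ) ⊆ {p : Euc N × ℝ | p.2 < T}

/-- `ψ ∈ C_c^∞(Q_T)` : smooth, compactly supported inside the open cylinder
`ℝ^N × (0,T)`. -/
def IsIntTestFn (T : ℝ) (ψ : Euc N → ℝ → ℝ) : Prop :=
  ContDiff ℝ (⊤ : ℕ∞) (Function.uncurry ψ) ∧ HasCompactSupport (Function.uncurry ψ) ∧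
    tsupport (Function.uncurry ψ) ⊆ {p : Euc N × ℝ | 0 < p.2 ∧ p.2 < T}

/-- The natural measure on the cylinder `Q_T = ℝ^N × (0,T)`. -/
def QTvol (N : ℕ) (T : ℝ) : Measure (Euc N × ℝ) :=
  (volume : Measure (Euc N)).prod ((volume : Measure ℝ).restrict (Ioo 0 T))

/-- `u ∈ L^∞(Q_T)`. -/
def MemLinfQT (T : ℝ) (u : Euc N → ℝ → ℝ) : Prop :=
  AEStronglyMeasurable (fun p : Euc N × ℝ => u p.1 p.2) (QTvol N T) ∧
    ∃ C : ℝ, ∀ᵐ p ∂(QTvol N T), |u p.1 p.2| ≤ C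

/-- `u ∈ L¹(Q_T)`. -/
def MemL1QT (T : ℝ) (u : Euc N → ℝ → ℝ) : Prop :=
  Integrable (fun p : Euc N × ℝ => u p.1 p.2) (QTvol N T)

/-- `u ∈ C([0,T]; L¹_loc(ℝ^N))` : for every compact `K`, `t ↦ u(·,t)` is continuous
from `[0,T]` into `L¹(K)`. -/
def MemCL1loc (T : ℝ) (u : Euc N → ℝ → ℝ) : Prop :=
  ∀ K : Set (Euc N), IsCompact K →
    (∀ t ∈ Icc (0 : ℝ) T, IntegrableOn (fun x => u x t) K) ∧
    ∀ t ∈ Icc (0 : ℝ) T,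
      Tendsto (fun s => ∫ x in K, |u x s - u x t|) (nhdsWithin t (Icc 0 T)) (nhds 0)

/-- `u` is a distributional solution of `∂_t u − A[φ(u)] = 0` in `Q_T` with initial
datum `u0` : for all `ψ ∈ C_c^∞(ℝ^N × [0,T))`,
`∫₀^T ∫ (u ∂_t ψ + φ(u) A[ψ(·,t)]) dx dt + ∫ u0(x) ψ(x,0) dx = 0`. -/
def IsDistSolOp (T : ℝ) (A : (Euc N → ℝ) → Euc N → ℝ) (φ : ℝ → ℝ)
    (u0 : Euc N → ℝ) (u : Euc N → ℝ → ℝ) : Prop :=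
  ∀ ψ : Euc N → ℝ → ℝ, IsSTTestFn T ψ →
    (∫ t in Ioo (0 : ℝ) T, ∫ x,
        (u x t * deriv (ψ x) t + φ (u x t) * A (fun y => ψ y t) x))
      + ∫ x, u0 x * ψ x 0 = 0

/-- `u0 ∈ L^∞(ℝ^N)`. -/
def MemLinfRn (u0 : Euc N → ℝ) : Prop :=
  AEStronglyMeasurable u0 (volume : Measure (Euc N)) ∧
    ∃ C : ℝ, ∀ᵐ x : Euc N ∂volume, |u0 x| ≤ C

end

open scoped Topology Convolution

/-- A Lévy measure is σ-finite, since it integrates the function `min(|z|²,1)`, which is nonzero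
almost everywhere. -/
theorem IsLevyMeasure.sigmaFinite {N : ℕ} {μ : Measure (Euc N)} (hμ : IsLevyMeasure μ) :
    SigmaFinite μ := by
  obtain ⟨h0, -, hfin⟩ := hμ
  have hmeas : Measurable fun z : Euc N => ENNReal.ofReal (min (‖z‖ ^ 2) 1) := by fun_prop
  have hne : ∀ᵐ z ∂μ, ENNReal.ofReal (min (‖z‖ ^ 2) 1) ≠ 0 := by
    have h : ∀ᵐ z ∂μ, z ≠ 0 := by simpa [ae_iff] using h0
    filter_upwards [h] with z hz
    simpa using hz
  have : IsFiniteMeasure (μ.withDensity fun z => ENNReal.ofReal (min (‖z‖ ^ 2) 1)) :=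
    isFiniteMeasure_withDensity hfin
  rw [← withDensity_inv_same hmeas hne (ae_of_all _ fun _ => ENNReal.ofReal_ne_top)]
  refine SigmaFinite.withDensity_of_ne_top ?_
  filter_upwards [(withDensity_absolutelyContinuous μ _).ae_le hne] with z hz
  simpa using hz

theorem IsLevyMeasure.integrable_min {N : ℕ} {μ : Measure (Euc N)} (hμ : IsLevyMeasure μ) :
    Integrable (fun z => min (‖z‖ ^ 2) 1) μ := by
  refine ⟨by fun_prop, ?_⟩
  rw [hasFiniteIntegral_iff_ofReal (ae_of_all _ fun z => by positivity)]
  exact hμ.2.2.lt_top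

/-- The integrand in the definition of `Lop`. -/
noncomputable def LopIntegrand {N : ℕ} (ψ : Euc N → ℝ) (x z : Euc N) : ℝ :=
  ψ (x + z) - ψ x - (if ‖z‖ ≤ 1 then fderiv ℝ ψ x z else 0)

theorem IsTestFn.integrable {N : ℕ} {ψ : Euc N → ℝ} (hψ : IsTestFn ψ) : Integrable ψ :=
  hψ.1.continuous.integrable_of_hasCompactSupport hψ.2

theorem IsTestFn.measurable_lopIntegrand {N : ℕ} {ψ : Euc N → ℝ} (hψ : IsTestFn ψ) :
    Measurable fun p : Euc N × Euc N => LopIntegrand ψ p.1 p.2 := by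
  have hc : Continuous ψ := hψ.1.continuous
  have hd : Continuous fun p : Euc N × Euc N => fderiv ℝ ψ p.1 p.2 :=
    ((hψ.1.continuous_fderiv (by simp)).comp continuous_fst).clm_apply continuous_snd
  unfold LopIntegrand
  refine Measurable.sub (by fun_prop) (Measurable.ite ?_ hd.measurable measurable_const)
  exact measurableSet_le (by fun_prop) measurable_const

theorem IsTestFn.integrable_lopIntegrand_left {N : ℕ} {ψ : Euc N → ℝ} (hψ : IsTestFn ψ)
    (z : Euc N) : Integrable fun x => LopIntegrand ψ x z := by
  refine ((hψ.integrable.comp_add_right z).sub hψ.integrable).sub ?_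
  split_ifs
  · have hd : Continuous fun x => fderiv ℝ ψ x z :=
      (hψ.1.continuous_fderiv (by simp)).clm_apply continuous_const
    exact hd.integrable_of_hasCompactSupport (hψ.2.fderiv_apply (𝕜 := ℝ) z)
  · exact integrable_zero _ _ _

/-- Second order Taylor bound for the integrand of `Lop`, uniform in the base point. -/
theorem IsTestFn.exists_abs_lopIntegrand_le {N : ℕ} {ψ : Euc N → ℝ} (hψ : IsTestFn ψ) :
    ∃ C : ℝ, ∀ x z : Euc N, ‖z‖ ≤ 1 → |LopIntegrand ψ x z| ≤ C * ‖z‖ ^ 2 := by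
  have hd : ContDiff ℝ 1 (fderiv ℝ ψ) := hψ.1.fderiv_right (m := 1) (WithTop.coe_le_coe.2 le_top)
  obtain ⟨C, hC⟩ := hd.lipschitzWith_of_hasCompactSupport (hψ.2.fderiv ℝ) (by simp)
  refine ⟨C, fun x z hz => ?_⟩
  have h := (convex_closedBall x ‖z‖).norm_image_sub_le_of_norm_fderiv_le' (𝕜 := ℝ) (f := ψ)
    (φ := fderiv ℝ ψ x) (C := C * ‖z‖) (x := x) (y := x + z)
    (fun y _ => (hψ.1.differentiable (by simp)) y)
    (fun y hy => (hC.norm_sub_le y x).trans (by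
      gcongr; simpa [dist_eq_norm] using hy)) (by simp) (by simp)
  simp only [add_sub_cancel_left, Real.norm_eq_abs] at h
  simp only [LopIntegrand, hz, if_true]
  linarith [h, sq ‖z‖, mul_assoc (C : ℝ) ‖z‖ ‖z‖]

theorem IsTestFn.exists_lopIntegrand_eq_zero {N : ℕ} {ψ : Euc N → ℝ} (hψ : IsTestFn ψ) :
    ∃ R : ℝ, ∀ x z : Euc N, ‖z‖ ≤ 1 → x ∉ Metric.closedBall 0 R → LopIntegrand ψ x z = 0 := by
  obtain ⟨R, hR⟩ := hψ.2.isCompact.isBounded.subset_closedBall (0 : Euc N)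
  refine ⟨R + 1, fun x z hz hx => ?_⟩
  have hx : R + 1 < ‖x‖ := by simpa using hx
  have h1 : x ∉ tsupport ψ := fun h => by
    have := hR h
    simp at this
    linarith
  have h2 : x + z ∉ tsupport ψ := fun h => by
    have := hR h
    simp at this
    have := norm_sub_le (x + z) z
    simp at this
    linarith
  simp [LopIntegrand, image_eq_zero_of_notMem_tsupport h1, image_eq_zero_of_notMem_tsupport h2,
    fderiv_of_notMem_tsupport ℝ h1]

theorem IsTestFn.exists_integral_abs_lopIntegrand_le {N : ℕ} {ψ : Euc N → ℝ} (hψ : IsTestFn ψ) :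
    ∃ K : ℝ, ∀ z : Euc N, ∫ x, ‖LopIntegrand ψ x z‖ ≤ K * min (‖z‖ ^ 2) 1 := by
  obtain ⟨C, hC⟩ := hψ.exists_abs_lopIntegrand_le
  obtain ⟨R, hR⟩ := hψ.exists_lopIntegrand_eq_zero
  set V := (volume : Measure (Euc N)).real (Metric.closedBall 0 R) with hV
  refine ⟨max (C * V) (2 * ∫ x, ‖ψ x‖), fun z => ?_⟩
  rcases le_or_gt ‖z‖ 1 with hz | hz
  · rw [min_eq_left (pow_le_one₀ (norm_nonneg z) hz)]
    calc ∫ x, ‖LopIntegrand ψ x z‖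
        ≤ ∫ x, (Metric.closedBall (0 : Euc N) R).indicator (fun _ => C * ‖z‖ ^ 2) x := by
          refine integral_mono (hψ.integrable_lopIntegrand_left z).norm
            ((integrable_indicator_iff measurableSet_closedBall).2
              (integrableOn_const measure_closedBall_lt_top.ne)) fun x => ?_
          by_cases hx : x ∈ Metric.closedBall (0 : Euc N) R
          · rw [indicator_of_mem hx]
            exact hC x z hz
          · simp [indicator_of_notMem hx, hR x z hz hx]
      _ = C * V * ‖z‖ ^ 2 := by
          rw [integral_indicator measurableSet_closedBall, setIntegral_const, smul_eq_mul]
          ring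
      _ ≤ _ := by gcongr; exact le_max_left _ _
  · rw [min_eq_right (one_le_pow₀ hz.le), mul_one]
    refine le_trans ?_ (le_max_right _ _)
    have hi := hψ.integrable.norm
    calc ∫ x, ‖LopIntegrand ψ x z‖ ≤ ∫ x, (‖ψ (x + z)‖ + ‖ψ x‖) := by
          refine integral_mono (hψ.integrable_lopIntegrand_left z).norm
            ((hi.comp_add_right z).add hi) fun x => ?_
          simpa [LopIntegrand, hz.not_ge] using norm_sub_le (ψ (x + z)) (ψ x)
      _ = 2 * ∫ x, ‖ψ x‖ := by
          rw [integral_add (hi.comp_add_right z) hi,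
            integral_add_right_eq_self (fun x => ‖ψ x‖) z]
          ring

/-- `L^μ[ψ] ∈ L¹` for test functions `ψ`. -/
theorem IsTestFn.integrable_lop {N : ℕ} {μ : Measure (Euc N)} (hμ : IsLevyMeasure μ)
    {ψ : Euc N → ℝ} (hψ : IsTestFn ψ) : Integrable (Lop μ ψ) := by
  have := hμ.sigmaFinite
  have hm := hψ.measurable_lopIntegrand
  obtain ⟨K, hK⟩ := hψ.exists_integral_abs_lopIntegrand_le
  have h : Integrable (fun p : Euc N × Euc N => LopIntegrand ψ p.1 p.2) (volume.prod μ) := by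
    refine (integrable_prod_iff' hm.aestronglyMeasurable).2
      ⟨ae_of_all _ hψ.integrable_lopIntegrand_left, ?_⟩
    refine (hμ.integrable_min.const_mul K).mono'
      hm.norm.stronglyMeasurable.integral_prod_left'.aestronglyMeasurable (ae_of_all _ fun z => ?_)
    rw [Real.norm_of_nonneg (integral_nonneg fun x => norm_nonneg _)]
    exact hK z
  exact h.integral_prod_left

theorem IsTestFn.comp_sub {N : ℕ} {ψ : Euc N → ℝ} (hψ : IsTestFn ψ) (a : Euc N) :
    IsTestFn fun y => ψ (y - a) :=
  ⟨hψ.1.comp (contDiff_id.sub contDiff_const),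
    hψ.2.comp_homeomorph (Homeomorph.subRight a)⟩

theorem lop_comp_sub {N : ℕ} (μ : Measure (Euc N)) (ψ : Euc N → ℝ) (a x : Euc N) :
    Lop μ (fun y => ψ (y - a)) x = Lop μ ψ (x - a) := by
  simp only [Lop, fderiv_comp_sub, add_sub_right_comm]

/-- A symmetric Lévy operator maps even functions to even functions. -/
theorem IsLevyMeasure.lop_neg {N : ℕ} {μ : Measure (Euc N)} (hμ : IsLevyMeasure μ)
    {ψ : Euc N → ℝ} (hψ : ∀ x, ψ (-x) = ψ x) (x : Euc N) : Lop μ ψ (-x) = Lop μ ψ x := by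
  have hfd : fderiv ℝ ψ (-x) = -fderiv ℝ ψ x := by
    have h := fderiv_comp_smul (𝕜 := ℝ) (f := ψ) (c := (-1 : ℝ)) (x := x)
    simp only [neg_smul, one_smul, hψ] at h
    rw [h, neg_neg]
  have hmp : MeasurePreserving (MeasurableEquiv.neg (Euc N)) μ μ :=
    ⟨(MeasurableEquiv.neg (Euc N)).measurable, hμ.2.1⟩
  unfold Lop
  rw [← hmp.integral_comp']
  refine integral_congr_ae (ae_of_all _ fun z => ?_)
  have h1 : ψ (-x + -z) = ψ (x + z) := by rw [← neg_add, hψ]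
  simp [hfd, h1, hψ]

/-- Fubini for the pairing of an integrable and a bounded function through an integrable
convolution kernel. -/
theorem integral_mul_integral_kernel_comm {N : ℕ} {a b k : Euc N → ℝ} (ha : Integrable a)
    (hb : MemLinfRn b) (hk : Integrable k) :
    ∫ x, a x * ∫ y, b y * k (y - x) = ∫ y, b y * ∫ x, a x * k (y - x) := by
  obtain ⟨hbm, C, hC⟩ := hb
  have h := ha.convolution_integrand (ContinuousLinearMap.mul ℝ ℝ) hk
  have h' : Integrable (fun p : Euc N × Euc N => b p.1 * (a p.2 * k (p.1 - p.2)))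
      (volume.prod volume) :=
    h.bdd_mul hbm.comp_fst (Measure.quasiMeasurePreserving_fst.ae hC)
  simp only [← integral_const_mul]
  rw [integral_integral_swap (f := fun y x => b y * (a x * k (y - x))) h']
  refine integral_congr_ae (ae_of_all _ fun x => integral_congr_ae (ae_of_all _ fun y => ?_))
  ring

/-- The duality identity for data regularised by an even test function. -/
theorem integral_mul_mollify_eq {N : ℕ} {μ : Measure (Euc N)} (hμ : IsLevyMeasure μ) {ε : ℝ}
    {g f vg vf ρ : Euc N → ℝ} (hf : Integrable f) (hvg : MemLinfRn vg) (hvf : Integrable vf)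
    (hvgsol : ∀ ψ : Euc N → ℝ, IsTestFn ψ →
      ∫ x, (ε * vg x * ψ x - vg x * Lop μ ψ x) = ∫ x, g x * ψ x)
    (hvfsol : ∀ ψ : Euc N → ℝ, IsTestFn ψ →
      ∫ x, (ε * vf x * ψ x - vf x * Lop μ ψ x) = ∫ x, f x * ψ x)
    (hρ : IsTestFn ρ) (hρneg : ∀ x, ρ (-x) = ρ x) :
    ∫ x, vf x * ∫ y, g y * ρ (y - x) = ∫ x, f x * ∫ y, vg y * ρ (y - x) := by
  set k : Euc N → ℝ := fun x => ε * ρ x - Lop μ ρ x with hk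
  have hki : Integrable k := (hρ.integrable.const_mul ε).sub (hρ.integrable_lop hμ)
  have hkneg : ∀ x, k (-x) = k x := fun x => by simp only [hk, hρneg, hμ.lop_neg hρneg]
  have hg' : ∀ x, ∫ y, g y * ρ (y - x) = ∫ y, vg y * k (y - x) := fun x => by
    rw [← hvgsol _ (hρ.comp_sub x)]
    simp only [lop_comp_sub, hk, mul_sub, mul_left_comm ε, mul_assoc]
  have hf' : ∀ y, ∫ x, vf x * k (y - x) = ∫ x, f x * ρ (y - x) := fun y => by
    have h := hvfsol _ (hρ.comp_sub y)
    simp only [lop_comp_sub] at h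
    simp only [← neg_sub _ y, hρneg, hkneg]
    rw [← h]
    simp only [hk, mul_sub, mul_left_comm ε, mul_assoc]
  simp only [hg']
  rw [integral_mul_integral_kernel_comm hvf hvg hki,
    integral_mul_integral_kernel_comm hf hvg hρ.integrable]
  simp only [hf']

theorem MemLinfRn.locallyIntegrable {N : ℕ} {b : Euc N → ℝ} (hb : MemLinfRn b) :
    LocallyIntegrable b := by
  obtain ⟨hbm, C, hC⟩ := hb
  exact (memLp_top_of_bound hbm C hC).locallyIntegrable le_top

/-- Mollifications of a bounded function converge weakly-* in `L^∞`. -/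
theorem MemLinfRn.tendsto_integral_mul_mollify {N : ℕ} {a b : Euc N → ℝ} (ha : Integrable a)
    (hb : MemLinfRn b) {φ : ℕ → ContDiffBump (0 : Euc N)}
    (hφ : Tendsto (fun n => (φ n).rOut) atTop (𝓝 0))
    (hφ' : ∀ᶠ n in atTop, (φ n).rOut ≤ 2 * (φ n).rIn) :
    Tendsto (fun n => ∫ x, a x * ∫ y, b y * (φ n).normed volume (y - x)) atTop
      (𝓝 (∫ x, a x * b x)) := by
  have hconv : ∀ n x, ((φ n).normed volume ⋆[ContinuousLinearMap.lsmul ℝ ℝ, volume] b) x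
      = ∫ y, b y * (φ n).normed volume (y - x) := fun n x => by
    rw [convolution_eq_swap]
    refine integral_congr_ae (ae_of_all _ fun y => ?_)
    simp only [ContinuousLinearMap.lsmul_apply, smul_eq_mul]
    rw [← neg_sub y x, (φ n).normed_neg, mul_comm]
  have hlim := ContDiffBump.ae_convolution_tendsto_right_of_locallyIntegrable hφ hφ'
    hb.locallyIntegrable
  simp only [hconv] at hlim
  have hbound : ∃ C : ℝ, ∀ n x, |∫ y, b y * (φ n).normed volume (y - x)| ≤ C := by
    obtain ⟨hbm, C, hC⟩ := hb
    refine ⟨C, fun n x => ?_⟩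
    have hi : Integrable fun y => (φ n).normed volume (y - x) :=
      (φ n).integrable_normed.comp_sub_right x
    calc |∫ y, b y * (φ n).normed volume (y - x)|
        ≤ ∫ y, C * (φ n).normed volume (y - x) := by
          rw [← Real.norm_eq_abs]
          refine norm_integral_le_of_norm_le (hi.const_mul C) ?_
          filter_upwards [hC] with y hy
          rw [norm_mul, Real.norm_of_nonneg ((φ n).nonneg_normed _)]
          exact mul_le_mul_of_nonneg_right hy ((φ n).nonneg_normed _)
      _ = C := by
          rw [integral_const_mul,
            integral_sub_right_eq_self (fun y => (φ n).normed volume y) x, (φ n).integral_normed,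
            mul_one]
  obtain ⟨C, hC⟩ := hbound
  refine tendsto_integral_of_dominated_convergence (fun x => ‖a x‖ * C) (fun n => ?_)
    (ha.norm.mul_const C) (fun n => ae_of_all _ fun x => ?_) ?_
  · have hc : Continuous
        ((φ n).normed volume ⋆[ContinuousLinearMap.lsmul ℝ ℝ, volume] b : Euc N → ℝ) :=
      (φ n).hasCompactSupport_normed.continuous_convolution_left
        (ContinuousLinearMap.lsmul ℝ ℝ : ℝ →L[ℝ] ℝ →L[ℝ] ℝ) (φ n).continuous_normed
        hb.locallyIntegrable
    exact ha.aestronglyMeasurable.mul (hc.aestronglyMeasurable.congr (ae_of_all _ (hconv n)))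
  · rw [norm_mul]
    exact mul_le_mul_of_nonneg_left (hC n x) (norm_nonneg _)
  · filter_upwards [hlim] with x hx using hx.const_mul (a x)

/-- Self-adjointness of the resolvent (Lemma 3.4).
If `εv_g − L^μ[v_g] = g` with `g, v_g ∈ L^∞` and `εv_f − L^μ[v_f] = f` with `f, v_f ∈ L¹`
(both in the distributional sense), then `∫ v_g f dx = ∫ g v_f dx`. -/
theorem resolvent_self_adjoint
    (N : ℕ) (hN : 0 < N)
    (μ : Measure (Euc N)) (hμ : IsLevyMeasure μ)
    (ε : ℝ) (hε : 0 < ε)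
    (g : Euc N → ℝ) (hg : MemLinfRn g)
    (f : Euc N → ℝ) (hf : Integrable f (volume : Measure (Euc N)))
    (vg : Euc N → ℝ) (hvg : MemLinfRn vg)
    (vf : Euc N → ℝ) (hvf : Integrable vf (volume : Measure (Euc N)))
    (hvgsol : ∀ ψ : Euc N → ℝ, IsTestFn ψ →
      ∫ x, (ε * vg x * ψ x - vg x * Lop μ ψ x) = ∫ x, g x * ψ x)
    (hvfsol : ∀ ψ : Euc N → ℝ, IsTestFn ψ →
      ∫ x, (ε * vf x * ψ x - vf x * Lop μ ψ x) = ∫ x, f x * ψ x) :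
    ∫ x, vg x * f x = ∫ x, g x * vf x := by
  let φ : ℕ → ContDiffBump (0 : Euc N) := fun n =>
    ⟨1 / ((n : ℝ) + 1), 2 * (1 / ((n : ℝ) + 1)), by positivity,
      lt_mul_of_one_lt_left (by positivity) one_lt_two⟩
  have hφ : Tendsto (fun n => (φ n).rOut) atTop (𝓝 0) := by
    simpa [φ] using (tendsto_one_div_add_atTop_nhds_zero_nat (𝕜 := ℝ)).const_mul 2
  have hφ' : ∀ᶠ n in atTop, (φ n).rOut ≤ 2 * (φ n).rIn := Eventually.of_forall fun _ => le_rfl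
  have h1 := hg.tendsto_integral_mul_mollify hvf hφ hφ'
  have h2 := hvg.tendsto_integral_mul_mollify hf hφ hφ'
  have h3 := tendsto_nhds_unique h2 (h1.congr fun n =>
    integral_mul_mollify_eq hμ hf hvg hvf hvgsol hvfsol
      ⟨(φ n).contDiff_normed, (φ n).hasCompactSupport_normed⟩ (φ n).normed_neg)
  simpa only [mul_comm] using h3
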